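/- Let u = (u₁,…,u_N) be a front-like entire solution approaching along edge i that is nondecreasing in t, and let v_j(x) := lim_{t→∞} u_j(t,x) (the limit profile). Let w = (w₁,…,w_N) be a stationary supersolution with 0 ≤ w_j ≤ 1, i.e., each w_j : [0,∞) → ℝ is continuous on [0,∞) and twice continuously differentiable on (0,∞) with w_j''(x) + f(w_j(x)) ≤ 0 for x > 0, the one-sided derivatives w_j'(0) exist, w₁(0) = ⋯ = w_N(0), and Σ_j ρ_j w_j'(0) ≤ 0 (super-Kirchhoff condition). If w_i(x) → 1 as x → ∞, then w_j(x) ≥ v_j(x) for every j ∈ {1,…,N} and every x ≥ 0. -/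

import Mathlib

open Set Filter Topology

/-- The primitive `F(s) = ∫₀^s f(r) dr`. -/
noncomputable def F (f : ℝ → ℝ) (s : ℝ) : ℝ := ∫ r in (0:ℝ)..s, f r

/-- Bistable nonlinearity with balanced-positive integral. -/
def Bistable (f : ℝ → ℝ) (a : ℝ) : Prop :=
  ContDiff ℝ 1 f ∧ 0 < a ∧ a < 1 ∧
  f 0 = 0 ∧ f a = 0 ∧ f 1 = 0 ∧
  (∀ s, 0 < s → s < a → f s < 0) ∧
  (∀ s, a < s → s < 1 → 0 < f s) ∧
  deriv f 0 < 0 ∧ 0 < deriv f a ∧ deriv f 1 < 0 ∧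
  0 < ∫ s in (0:ℝ)..(1:ℝ), f s


/-- A classical solution of `∂_t u = ∂_x² u + f(u)` on `ℝ × [0,∞)`:
`u`, `∂_t u`, `∂_x u`, `∂_x² u` exist and are continuous there and the
equation holds. -/
def IsEntireSol (f : ℝ → ℝ) (u : ℝ → ℝ → ℝ) : Prop :=
  ContinuousOn (fun p : ℝ × ℝ => u p.1 p.2) ((univ : Set ℝ) ×ˢ Ici 0) ∧
  (∀ t : ℝ, ∀ x : ℝ, 0 ≤ x →
    DifferentiableAt ℝ (fun τ => u τ x) t ∧
    DifferentiableAt ℝ (u t) x ∧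
    DifferentiableAt ℝ (deriv (u t)) x) ∧
  ContinuousOn (fun p : ℝ × ℝ => deriv (fun τ => u τ p.2) p.1) ((univ : Set ℝ) ×ˢ Ici 0) ∧
  ContinuousOn (fun p : ℝ × ℝ => deriv (u p.1) p.2) ((univ : Set ℝ) ×ˢ Ici 0) ∧
  ContinuousOn (fun p : ℝ × ℝ => deriv (deriv (u p.1)) p.2) ((univ : Set ℝ) ×ˢ Ici 0) ∧
  (∀ t : ℝ, ∀ x : ℝ, 0 ≤ x →
    deriv (fun τ => u τ x) t = deriv (deriv (u t)) x + f (u t x))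

/-- A front-like entire solution on a star graph with `N` half-line edges of
thicknesses `ρ`, approaching along edge `i` like the traveling wave
`φ(−x − ct)` as `t → −∞`, and vanishing (uniformly) on the other edges. -/
def FrontLike (f : ℝ → ℝ) (c : ℝ) (φ : ℝ → ℝ) {N : ℕ} (ρ : Fin N → ℝ) (i : Fin N)
    (u : Fin N → ℝ → ℝ → ℝ) : Prop :=
  (∀ j, IsEntireSol f (u j)) ∧
  (∀ j, ∀ t : ℝ, ∀ x : ℝ, 0 ≤ x → 0 < u j t x ∧ u j t x < 1) ∧
  (∀ t : ℝ, ∀ j k, u j t 0 = u k t 0) ∧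
  (∀ t : ℝ, (∑ j, ρ j * derivWithin (u j t) (Ici 0) 0) = 0) ∧
  (∀ ε : ℝ, 0 < ε → ∃ T : ℝ, ∀ t : ℝ, t ≤ T → ∀ x : ℝ, 0 ≤ x →
    |u i t x - φ (-x - c * t)| < ε ∧ ∀ j, j ≠ i → |u j t x| < ε)

/-- `φ` is the (unique, normalized) bistable traveling wave of speed `c`. -/
def TravelingWave (f : ℝ → ℝ) (a c : ℝ) (φ : ℝ → ℝ) : Prop :=
  ContDiff ℝ 2 φ ∧
  (∀ z : ℝ, deriv (deriv φ) z + c * deriv φ z + f (φ z) = 0) ∧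
  (∀ z : ℝ, 0 < φ z ∧ φ z < 1) ∧
  Tendsto φ atBot (𝓝 1) ∧ Tendsto φ atTop (𝓝 0) ∧
  (∀ z : ℝ, deriv φ z < 0) ∧ φ 0 = a

theorem IsLocalMax.hasDerivAt_deriv_nonpos {g : ℝ → ℝ} {x g2 : ℝ} (h : IsLocalMax g x)
    (hg : ∀ᶠ ξ in 𝓝 x, DifferentiableAt ℝ g ξ) (h2 : HasDerivAt (deriv g) g2 x) : g2 ≤ 0 := by
  by_contra! hpos
  have hmin : IsLocalMin g x :=
    isLocalMin_of_deriv_deriv_pos (by rwa [h2.deriv]) h.deriv_eq_zero hg.self_of_nhds.continuousAt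
  have hconst : g =ᶠ[𝓝 x] fun _ => g x := by
    filter_upwards [h, hmin] with y h1 h2 using le_antisymm h1 h2
  have hderiv : deriv g =ᶠ[𝓝 x] fun _ => 0 := by
    simpa using hconst.deriv
  have := (h2.congr_of_eventuallyEq hderiv.symm).unique (hasDerivAt_const x (0 : ℝ))
  linarith

theorem HasDerivAt.nonneg_of_le_left {g : ℝ → ℝ} {s t g1 : ℝ} (hst : s < t)
    (h : HasDerivAt g g1 t) (hmax : ∀ τ ∈ Icc s t, g τ ≤ g t) : 0 ≤ g1 := by
  have h1 : Tendsto (slope g t) (𝓝[<] t) (𝓝 g1) :=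
    (hasDerivAt_iff_tendsto_slope.1 h).mono_left (nhdsWithin_mono _ fun y hy => ne_of_lt hy)
  refine ge_of_tendsto h1 ?_
  filter_upwards [Ioo_mem_nhdsLT hst] with τ hτ
  rw [slope_def_field]
  exact div_nonneg_of_nonpos (by linarith [hmax τ ⟨hτ.1.le, hτ.2.le⟩]) (by linarith [hτ.2])

theorem HasDerivWithinAt.nonpos_of_le_right {g : ℝ → ℝ} {x R g1 : ℝ} (hR : x < R)
    (h : HasDerivWithinAt g g1 (Ici x) x) (hmax : ∀ ξ ∈ Icc x R, g ξ ≤ g x) : g1 ≤ 0 := by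
  have h1 : Tendsto (slope g x) (𝓝[>] x) (𝓝 g1) := by
    simpa using hasDerivWithinAt_iff_tendsto_slope.1 h
  refine le_of_tendsto h1 ?_
  filter_upwards [Ioo_mem_nhdsGT hR] with τ hτ
  rw [slope_def_field]
  exact div_nonpos_of_nonpos_of_nonneg (by linarith [hmax τ ⟨hτ.1.le, hτ.2.le⟩])
    (by linarith [hτ.1])

/-- Weak parabolic maximum principle on a star graph, for bounded functions that are subsolutions
of the heat equation wherever they are positive. -/
theorem star_heat_le_of_initial_le {N : ℕ} {ρ : Fin N → ℝ} (hρ : ∀ j, 0 < ρ j)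
    {y : Fin N → ℝ → ℝ → ℝ} {s t₁ M B : ℝ} (hst : s ≤ t₁) (hM : 0 ≤ M)
    (hcont : ∀ j, ContinuousOn (fun p : ℝ × ℝ => y j p.1 p.2) ((univ : Set ℝ) ×ˢ Ici 0))
    (hbd : ∀ j t x, s ≤ t → t ≤ t₁ → 0 ≤ x → y j t x ≤ B)
    (hjunc : ∀ t j k, y j t 0 = y k t 0)
    (hK : ∀ t, ∃ d : Fin N → ℝ, (∀ j, HasDerivWithinAt (y j t) (d j) (Ici 0) 0) ∧
      0 ≤ ∑ j, ρ j * d j)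
    (hpde : ∀ j t x, s < t → t ≤ t₁ → 0 < x → 0 < y j t x → ∃ yt yxx : ℝ,
      HasDerivAt (fun τ => y j τ x) yt t ∧ (∀ᶠ ξ in 𝓝 x, DifferentiableAt ℝ (y j t) ξ) ∧
      HasDerivAt (deriv (y j t)) yxx x ∧ yt ≤ yxx)
    (hinit : ∀ j x, 0 ≤ x → y j s x ≤ M) (j : Fin N) {x : ℝ} (hx : 0 ≤ x) :
    y j t₁ x ≤ M := by
  by_contra! hlt
  have hψ : ∀ ξ : ℝ, 0 < ξ ^ 2 - ξ + 1 := fun ξ => by nlinarith [sq_nonneg (ξ - 1 / 2)]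
  obtain ⟨ε, hε, hεlt⟩ : ∃ ε > 0, ε * (x ^ 2 - x + 1 + 3 * (t₁ - s)) < y j t₁ x - M := by
    have hD : 0 < x ^ 2 - x + 1 + 3 * (t₁ - s) := by linarith [hψ x]
    refine ⟨(y j t₁ x - M) / (x ^ 2 - x + 1 + 3 * (t₁ - s)) / 2, ?_, ?_⟩
    · have : 0 < y j t₁ x - M := by linarith
      positivity
    · have : 0 < y j t₁ x - M := by linarith
      rw [div_div, mul_comm _ (2 : ℝ), ← div_div, div_mul_cancel₀ _ hD.ne']
      linarith
  set Z : Fin N → ℝ → ℝ → ℝ :=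
    fun k τ ξ => y k τ ξ - (M + ε * (ξ ^ 2 - ξ + 1 + 3 * (τ - s))) with hZ
  set R : ℝ := x + |B| / ε + 1 with hR
  have hR1 : 1 ≤ R := by have : 0 ≤ |B| / ε := by positivity
                         linarith
  have hRx : x < R := by have : 0 ≤ |B| / ε := by positivity
                         linarith
  have hRB : B ≤ ε * (R ^ 2 - R + 1) := by
    have h1 : |B| / ε ≤ R ^ 2 - R + 1 := by nlinarith [sq_nonneg (R - 1)]
    calc B ≤ |B| := le_abs_self B
      _ = ε * (|B| / ε) := by field_simp
      _ ≤ _ := by gcongr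
  have hZcont : ∀ k, ContinuousOn (fun p : ℝ × ℝ => Z k p.1 p.2) (Icc s t₁ ×ˢ Icc 0 R) := by
    intro k
    refine ContinuousOn.sub ((hcont k).mono fun p hp => ⟨mem_univ _, hp.2.1⟩) ?_
    fun_prop
  have hne : (Icc s t₁ ×ˢ Icc 0 R : Set (ℝ × ℝ)).Nonempty :=
    ⟨(t₁, x), ⟨hst, le_rfl⟩, hx, hRx.le⟩
  choose P hPmem hPmax using fun k =>
    (isCompact_Icc.prod isCompact_Icc).exists_isMaxOn hne (hZcont k)
  have : Nonempty (Fin N) := ⟨j⟩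
  obtain ⟨k, hk⟩ := Finite.exists_max fun k => Z k (P k).1 (P k).2
  rcases hp : P k with ⟨t, ξ⟩
  have hmem := hPmem k
  rw [hp] at hmem hk
  obtain ⟨⟨hts, htt⟩, hξ0, hξR⟩ := hmem
  simp only at hts htt hξ0 hξR hk
  have hmax : ∀ l τ η, s ≤ τ → τ ≤ t₁ → 0 ≤ η → η ≤ R → Z l τ η ≤ Z k t ξ :=
    fun l τ η h1 h2 h3 h4 => le_trans (hPmax l (a := (τ, η)) ⟨⟨h1, h2⟩, h3, h4⟩) (hk l)
  have hpos : 0 < Z k t ξ := by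
    refine lt_of_lt_of_le ?_ (hmax j t₁ x hst le_rfl hx hRx.le)
    simp only [hZ]
    linarith
  have hts' : s < t := by
    refine lt_of_le_of_ne hts fun h => ?_
    subst h
    simp only [hZ] at hpos
    nlinarith [hinit k ξ hξ0, hψ ξ]
  have hξR' : ξ < R := by
    refine lt_of_le_of_ne hξR fun h => ?_
    rw [h] at hpos
    simp only [hZ] at hpos
    nlinarith [hbd k t R hts htt (by linarith)]
  rcases hξ0.eq_or_lt with h0 | h0
  · subst h0
    obtain ⟨d, hd, hsum⟩ := hK t
    have hd' : ∀ l, d l + ε ≤ 0 := by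
      intro l
      have hder : HasDerivWithinAt (Z l t) (d l - ε * (2 * 0 - 1)) (Ici 0) 0 := by
        refine (hd l).sub (HasDerivAt.hasDerivWithinAt ?_)
        have h1 : HasDerivAt (fun η : ℝ => η ^ 2 - η + 1 + 3 * (t - s)) (2 * 0 - 1) 0 := by
          simpa using ((((hasDerivAt_id (0 : ℝ)).pow 2).sub
            (hasDerivAt_id (0 : ℝ))).add_const 1).add_const (3 * (t - s))
        exact (h1.const_mul ε).const_add M
      have := hder.nonpos_of_le_right (R := R) (by linarith) fun η hη => by
        have h1 : Z k t 0 = Z l t 0 := by simp only [hZ]; rw [hjunc t k l]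
        rw [← h1]
        exact hmax l t η hts htt hη.1 hη.2
      linarith
    have : ∑ l, ρ l * d l < 0 := by
      refine Finset.sum_neg (fun l _ => ?_) Finset.univ_nonempty
      exact mul_neg_of_pos_of_neg (hρ l) (by linarith [hd' l])
    linarith
  · have hypos : 0 < y k t ξ := by
      simp only [hZ] at hpos
      have := mul_pos hε (hψ ξ)
      nlinarith
    obtain ⟨yt, yxx, hyt, hdiff, hyxx, hle⟩ := hpde k t ξ hts' htt h0 hypos
    have hq : ∀ η : ℝ, HasDerivAt
        (fun η : ℝ => M + ε * (η ^ 2 - η + 1 + 3 * (t - s))) (ε * (2 * η - 1)) η := by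
      intro η
      have h1 : HasDerivAt (fun η : ℝ => η ^ 2 - η + 1 + 3 * (t - s)) (2 * η - 1) η := by
        simpa using ((((hasDerivAt_id η).pow 2).sub
          (hasDerivAt_id η)).add_const 1).add_const (3 * (t - s))
      exact (h1.const_mul ε).const_add M
    have hZt : 0 ≤ yt - ε * 3 := by
      have h1 : HasDerivAt (fun τ => Z k τ ξ) (yt - ε * 3) t := by
        refine hyt.sub ?_
        have := ((((hasDerivAt_id t).sub_const s).const_mul 3).const_add
          (ξ ^ 2 - ξ + 1)).const_mul ε
        simpa using this.const_add M
      exact h1.nonneg_of_le_left hts' fun τ hτ =>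
        hmax k τ ξ hτ.1 (hτ.2.trans htt) hξ0 hξR
    have hZxx : yxx - ε * 2 ≤ 0 := by
      have hmaxloc : IsLocalMax (Z k t) ξ := by
        filter_upwards [Ioo_mem_nhds h0 hξR'] with η hη
        exact hmax k t η hts htt hη.1.le hη.2.le
      refine hmaxloc.hasDerivAt_deriv_nonpos ?_ ?_
      · filter_upwards [hdiff] with η hη
        exact hη.sub (hq η).differentiableAt
      · have h1 : deriv (Z k t) =ᶠ[𝓝 ξ] fun η => deriv (y k t) η - ε * (2 * η - 1) := by
          filter_upwards [hdiff] with η hη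
          exact (hη.hasDerivAt.sub (hq η)).deriv
        refine HasDerivAt.congr_of_eventuallyEq ?_ h1
        refine hyxx.sub ?_
        simpa using (((hasDerivAt_id ξ).const_mul 2).sub_const 1).const_mul ε
    linarith

/-- A subsolution of `w'' = k² w` with vanishing Cauchy data at `x₀` is nonpositive to the right
of `x₀`. -/
theorem nonpos_of_deriv_deriv_le_sq_mul {w w₁ w₂ : ℝ → ℝ} {x₀ k : ℝ}
    (hcont : ContinuousOn w (Ici x₀)) (h₁ : ∀ x, x₀ < x → HasDerivAt w (w₁ x) x)
    (h₂ : ∀ x, x₀ < x → HasDerivAt w₁ (w₂ x) x) (hle : ∀ x, x₀ < x → w₂ x ≤ k ^ 2 * w x)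
    (h0 : w x₀ = 0) (hd0 : HasDerivWithinAt w 0 (Ici x₀) x₀) {x : ℝ} (hx : x₀ ≤ x) :
    w x ≤ 0 := by
  have hexp : ∀ b x : ℝ, HasDerivAt (fun y => Real.exp (b * y)) (Real.exp (b * x) * b) x := by
    intro b x
    simpa using ((hasDerivAt_id x).const_mul b).exp
  set E : ℝ → ℝ := fun y => Real.exp (k * y) * (w₁ y - k * w y) with hE
  set g : ℝ → ℝ := fun y => Real.exp (-k * y) * w y with hg
  have hE' : ∀ y, x₀ < y → HasDerivAt E (Real.exp (k * y) * (w₂ y - k ^ 2 * w y)) y := by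
    intro y hy
    refine ((hexp k y).mul ((h₂ y hy).sub ((h₁ y hy).const_mul k))).congr_deriv ?_
    simp only [Pi.sub_apply]
    ring
  have hg' : ∀ y, x₀ < y → HasDerivAt g (Real.exp (-k * y) * (w₁ y - k * w y)) y := by
    intro y hy
    refine ((hexp (-k) y).mul (h₁ y hy)).congr_deriv ?_
    ring
  have hgcont : ContinuousOn g (Ici x₀) := by
    refine ContinuousOn.mul ?_ hcont
    fun_prop
  have hEanti : AntitoneOn E (Ioi x₀) := by
    refine antitoneOn_of_deriv_nonpos (convex_Ioi x₀)
      (fun y hy => (hE' y hy).continuousAt.continuousWithinAt) ?_ ?_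
    · rw [interior_Ioi]
      exact fun y hy => (hE' y hy).differentiableAt.differentiableWithinAt
    · rw [interior_Ioi]
      intro y hy
      rw [(hE' y hy).deriv]
      exact mul_nonpos_of_nonneg_of_nonpos (Real.exp_pos _).le (by linarith [hle y hy])
  have hp : ∀ y, x₀ < y → w₁ y - k * w y ≤ 0 := by
    intro x₁ hx₁
    by_contra! hpos
    have hEpos : 0 < E x₁ := mul_pos (Real.exp_pos _) hpos
    obtain ⟨m, hm, hmle⟩ : ∃ m > 0, ∀ y ∈ Icc x₀ x₁, m ≤ Real.exp (-(2 * k) * y) := by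
      obtain ⟨z, -, hz⟩ := isCompact_Icc.exists_isMinOn (nonempty_Icc.2 hx₁.le)
        (f := fun y => Real.exp (-(2 * k) * y)) (by fun_prop)
      exact ⟨_, Real.exp_pos _, fun y hy => hz hy⟩
    have hslope := (convex_Icc x₀ x₁).mul_sub_le_image_sub_of_le_deriv (C := m * E x₁)
      (hgcont.mono Icc_subset_Ici_self)
      (by rw [interior_Icc]
          exact fun y hy => (hg' y hy.1).differentiableAt.differentiableWithinAt)
      (by rw [interior_Icc]
          intro y hy
          rw [(hg' y hy.1).deriv]
          have h3 : Real.exp (-k * y) * (w₁ y - k * w y) = Real.exp (-(2 * k) * y) * E y := by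
            simp only [hE]
            rw [← mul_assoc, ← Real.exp_add]
            ring_nf
          rw [h3]
          exact mul_le_mul (hmle y ⟨hy.1.le, hy.2.le⟩) (hEanti hy.1 hx₁ hy.2.le) hEpos.le
            (Real.exp_pos _).le)
    have hgd : HasDerivWithinAt g 0 (Ici x₀) x₀ := by
      refine ((hexp (-k) x₀).hasDerivWithinAt.mul hd0).congr_deriv ?_
      simp [h0]
    have hlin : HasDerivWithinAt (fun y : ℝ => m * E x₁ * y) (m * E x₁) (Ici x₀) x₀ := by
      simpa using ((hasDerivAt_id x₀).const_mul (m * E x₁)).hasDerivWithinAt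
    have := (hlin.sub hgd).nonpos_of_le_right hx₁ fun y hy => by
      have := hslope x₀ ⟨le_rfl, hx₁.le⟩ y hy hy.1
      simp only [Pi.sub_apply]
      linarith
    have := mul_pos hm hEpos
    linarith
  have hganti : AntitoneOn g (Ici x₀) := by
    refine antitoneOn_of_deriv_nonpos (convex_Ici x₀) hgcont ?_ ?_
    · rw [interior_Ici]
      exact fun y hy => (hg' y hy).differentiableAt.differentiableWithinAt
    · rw [interior_Ici]
      intro y hy
      rw [(hg' y hy).deriv]
      exact mul_nonpos_of_nonneg_of_nonpos (Real.exp_pos _).le (hp y hy)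
  have h4 : g x ≤ g x₀ := hganti self_mem_Ici hx hx
  simp only [hg, h0, mul_zero] at h4
  exact nonpos_of_mul_nonpos_right h4 (Real.exp_pos _)

theorem exists_sub_le_neg_mul_sub_of_deriv_neg {f : ℝ → ℝ} (hf : ContDiff ℝ 1 f) {p : ℝ}
    (hp : deriv f p < 0) : ∃ η > 0, ∃ δ > 0, ∀ r s, p - η ≤ r → r ≤ s → s ≤ p + η →
      f s - f r ≤ -δ * (s - r) := by
  have hc : Continuous (deriv f) := hf.continuous_deriv_one
  have hev : ∀ᶠ x in 𝓝 p, deriv f x < deriv f p / 2 :=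
    hc.continuousAt.eventually_lt_const (by linarith)
  obtain ⟨η, hη, hball⟩ := Metric.nhds_basis_closedBall.eventually_iff.1 hev
  refine ⟨η, hη, -(deriv f p / 2), by linarith, fun r s hr hrs hs => ?_⟩
  rw [neg_neg]
  refine (convex_Icc (p - η) (p + η)).image_sub_le_mul_sub_of_deriv_le
    hf.continuous.continuousOn (hf.differentiable one_ne_zero).differentiableOn ?_
    r ⟨hr, hrs.trans hs⟩ s ⟨hr.trans hrs, hs⟩ hrs
  intro x hx
  have hx' := interior_subset hx
  rw [← Real.closedBall_eq_Icc] at hx'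
  exact (hball hx').le

/-- A `C¹` function is Lipschitz on the unit interval. -/
theorem exists_abs_sub_le_mul_of_contDiff {f : ℝ → ℝ} (hf : ContDiff ℝ 1 f) :
    ∃ K > 0, ∀ r ∈ Icc (0 : ℝ) 1, ∀ s ∈ Icc (0 : ℝ) 1, |f s - f r| ≤ K * |s - r| := by
  obtain ⟨K, hK⟩ := isCompact_Icc.exists_bound_of_continuousOn (s := Icc (0 : ℝ) 1)
    hf.continuous_deriv_one.continuousOn
  refine ⟨max K 1, by positivity, fun r hr s hs => ?_⟩
  have := (convex_Icc (0 : ℝ) 1).norm_image_sub_le_of_norm_deriv_le (C := max K 1)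
    (fun x _ => hf.differentiable one_ne_zero x) (fun x hx => (hK x hx).trans (le_max_left _ _))
    hr hs
  simpa [Real.norm_eq_abs] using this

theorem ContDiffOn.deriv_regularity_Ioi {w : ℝ → ℝ} (hw : ContDiffOn ℝ 2 w (Ioi 0)) {x : ℝ}
    (hx : 0 < x) : DifferentiableAt ℝ w x ∧ DifferentiableAt ℝ (deriv w) x := by
  refine ⟨(hw.differentiableOn two_ne_zero).differentiableAt (Ioi_mem_nhds hx), ?_⟩
  have h1 : ContDiffOn ℝ 1 (deriv w) (Ioi 0) := hw.deriv_of_isOpen isOpen_Ioi (by norm_num)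
  exact (h1.differentiableOn one_ne_zero).differentiableAt (Ioi_mem_nhds hx)

/-- Parabolic comparison of a solution with a stationary supersolution on a star graph. -/
theorem star_sub_le_mul_exp {f : ℝ → ℝ} {N : ℕ} {ρ : Fin N → ℝ} (hρ : ∀ j, 0 < ρ j)
    {u : Fin N → ℝ → ℝ → ℝ} (hsol : ∀ j, IsEntireSol f (u j))
    (hub : ∀ j, ∀ t : ℝ, ∀ x : ℝ, 0 ≤ x → 0 < u j t x ∧ u j t x < 1)
    (hujunc : ∀ t : ℝ, ∀ j k, u j t 0 = u k t 0)
    (huK : ∀ t : ℝ, (∑ j, ρ j * derivWithin (u j t) (Ici 0) 0) = 0)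
    {w : Fin N → ℝ → ℝ}
    (hwcont : ∀ j, ContinuousOn (w j) (Ici 0))
    (hwC2 : ∀ j, ContDiffOn ℝ 2 (w j) (Ioi 0))
    (hwineq : ∀ j, ∀ x : ℝ, 0 < x → deriv (deriv (w j)) x + f (w j x) ≤ 0)
    (hwdiff0 : ∀ j, DifferentiableWithinAt ℝ (w j) (Ici 0) 0)
    (hw0 : ∀ j, ∀ x : ℝ, 0 ≤ x → 0 ≤ w j x)
    (hwjunc : ∀ j k, w j 0 = w k 0)
    (hwK : (∑ j, ρ j * derivWithin (w j) (Ici 0) 0) ≤ 0)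
    {C s t₁ M : ℝ} (hst : s ≤ t₁) (hM : 0 ≤ M)
    (hC : ∀ j t x, s < t → t ≤ t₁ → 0 < x → w j x < u j t x →
      f (u j t x) - f (w j x) ≤ C * (u j t x - w j x))
    (hinit : ∀ j x, 0 ≤ x → u j s x - w j x ≤ M * Real.exp (C * s))
    (j : Fin N) {x : ℝ} (hx : 0 ≤ x) : u j t₁ x - w j x ≤ M * Real.exp (C * t₁) := by
  have hexp : ∀ t : ℝ, Real.exp (-C * t) * Real.exp (C * t) = 1 := fun t => by
    rw [← Real.exp_add]; simp
  have key := star_heat_le_of_initial_le hρ (s := s) (t₁ := t₁) (M := M)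
    (B := Real.exp (|C| * max |s| |t₁|))
    (y := fun j t x => Real.exp (-C * t) * (u j t x - w j x)) hst hM ?_ ?_ ?_ ?_ ?_ ?_ j hx
  · calc u j t₁ x - w j x
        = Real.exp (-C * t₁) * (u j t₁ x - w j x) * Real.exp (C * t₁) := by
          linear_combination -(u j t₁ x - w j x) * hexp t₁
      _ ≤ M * Real.exp (C * t₁) := by gcongr
  · intro j
    refine ContinuousOn.mul (by fun_prop) ((hsol j).1.sub ?_)
    exact (hwcont j).comp continuousOn_snd fun p hp => hp.2
  · intro j t x hs ht hx
    have h1 : u j t x - w j x ≤ 1 := by linarith [(hub j t x hx).2, hw0 j x hx]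
    have h2 : -C * t ≤ |C| * max |s| |t₁| :=
      calc -C * t ≤ |-C * t| := le_abs_self _
        _ = |C| * |t| := by rw [abs_mul, abs_neg]
        _ ≤ _ := by gcongr; exact abs_le_max_abs_abs hs ht
    calc Real.exp (-C * t) * (u j t x - w j x) ≤ Real.exp (-C * t) * 1 := by gcongr
      _ ≤ _ := by rw [mul_one]; gcongr
  · intro t j k
    simp only [hujunc t j k, hwjunc j k]
  · intro t
    refine ⟨fun j => Real.exp (-C * t) *
      (derivWithin (u j t) (Ici 0) 0 - derivWithin (w j) (Ici 0) 0), fun j => ?_, ?_⟩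
    · exact (((hsol j).2.1 t 0 le_rfl).2.1.differentiableWithinAt.hasDerivWithinAt.sub
        (hwdiff0 j).hasDerivWithinAt).const_mul _
    · have : ∑ j, ρ j * (Real.exp (-C * t) *
          (derivWithin (u j t) (Ici 0) 0 - derivWithin (w j) (Ici 0) 0)) =
          Real.exp (-C * t) * (∑ j, ρ j * derivWithin (u j t) (Ici 0) 0 -
            ∑ j, ρ j * derivWithin (w j) (Ici 0) 0) := by
        rw [← Finset.sum_sub_distrib, Finset.mul_sum]
        exact Finset.sum_congr rfl fun j _ => by ring
      rw [this, huK t]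
      exact mul_nonneg (Real.exp_pos _).le (by linarith)
  · intro j t x hs ht hx hpos
    have hpos' : w j x < u j t x := by
      have := pos_of_mul_pos_right hpos (Real.exp_pos _).le
      linarith
    obtain ⟨-, hdiff, -, -, -, heq⟩ := hsol j
    refine ⟨Real.exp (-C * t) * (-C) * (u j t x - w j x) +
        Real.exp (-C * t) * deriv (fun τ => u j τ x) t,
      Real.exp (-C * t) * (deriv (deriv (u j t)) x - deriv (deriv (w j)) x), ?_, ?_, ?_, ?_⟩
    · have h1 : HasDerivAt (fun τ => Real.exp (-C * τ)) (Real.exp (-C * t) * (-C)) t := by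
        simpa using ((hasDerivAt_id t).const_mul (-C)).exp
      exact h1.mul ((hdiff t x hx.le).1.hasDerivAt.sub_const (w j x))
    · filter_upwards [Ioi_mem_nhds hx] with ξ hξ
      exact ((hdiff t ξ (le_of_lt hξ)).2.1.sub ((hwC2 j).deriv_regularity_Ioi hξ).1).const_mul _
    · have h1 : deriv (fun ξ => Real.exp (-C * t) * (u j t ξ - w j ξ)) =ᶠ[𝓝 x]
          fun ξ => Real.exp (-C * t) * (deriv (u j t) ξ - deriv (w j) ξ) := by
        filter_upwards [Ioi_mem_nhds hx] with ξ hξ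
        exact (((hdiff t ξ (le_of_lt hξ)).2.1.hasDerivAt.sub
          ((hwC2 j).deriv_regularity_Ioi hξ).1.hasDerivAt).const_mul _).deriv
      refine HasDerivAt.congr_of_eventuallyEq ?_ h1
      exact ((hdiff t x hx.le).2.2.hasDerivAt.sub
        ((hwC2 j).deriv_regularity_Ioi hx).2.hasDerivAt).const_mul _
    · have h1 := hC j t x hs ht hx hpos'
      have h2 := hwineq j x hx
      rw [heq t x hx.le, mul_assoc, ← mul_add]
      gcongr
      linarith
  · intro j x hx
    calc Real.exp (-C * s) * (u j s x - w j x)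
        ≤ Real.exp (-C * s) * (M * Real.exp (C * s)) := by gcongr; exact hinit j x hx
      _ = M := by linear_combination M * hexp s

/-- A stationary supersolution that does not vanish along an edge is positive on that edge,
junction included. -/
theorem star_supersolution_pos {f : ℝ → ℝ} (hf : ContDiff ℝ 1 f) (hf0 : f 0 = 0) {N : ℕ}
    {ρ : Fin N → ℝ} (hρ : ∀ j, 0 < ρ j) {i : Fin N} {w : Fin N → ℝ → ℝ}
    (hwcont : ∀ j, ContinuousOn (w j) (Ici 0))
    (hwC2 : ∀ j, ContDiffOn ℝ 2 (w j) (Ioi 0))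
    (hwineq : ∀ j, ∀ x : ℝ, 0 < x → deriv (deriv (w j)) x + f (w j x) ≤ 0)
    (hwdiff0 : ∀ j, DifferentiableWithinAt ℝ (w j) (Ici 0) 0)
    (hwbd : ∀ j, ∀ x : ℝ, 0 ≤ x → 0 ≤ w j x ∧ w j x ≤ 1)
    (hwjunc : ∀ j k, w j 0 = w k 0)
    (hwK : (∑ j, ρ j * derivWithin (w j) (Ici 0) 0) ≤ 0)
    (hwlim : Tendsto (w i) atTop (𝓝 1)) {x : ℝ} (hx : 0 ≤ x) : 0 < w i x := by
  refine lt_of_le_of_ne (hwbd i x hx).1 fun hzero => ?_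
  have hd0 : HasDerivWithinAt (w i) 0 (Ici x) x := by
    rcases hx.eq_or_lt with h | h
    · subst h
      have hnn : ∀ j, 0 ≤ ρ j * derivWithin (w j) (Ici 0) 0 := by
        intro j
        refine mul_nonneg (hρ j).le ?_
        have := (hwdiff0 j).hasDerivWithinAt.neg.nonpos_of_le_right one_pos fun ξ hξ => by
          have h1 := (hwbd j ξ hξ.1).1
          have h2 := hwjunc j i
          simp only [Pi.neg_apply]
          linarith
        linarith
      have hi : ρ i * derivWithin (w i) (Ici 0) 0 = 0 :=
        (Finset.sum_eq_zero_iff_of_nonneg fun j _ => hnn j).1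
          (le_antisymm hwK (Finset.sum_nonneg fun j _ => hnn j)) i (Finset.mem_univ i)
      have := (hwdiff0 i).hasDerivWithinAt
      rwa [(mul_eq_zero.1 hi).resolve_left (hρ i).ne'] at this
    · have hmin : IsLocalMin (w i) x := by
        filter_upwards [Ioi_mem_nhds h] with ξ hξ
        rw [← hzero]
        exact (hwbd i ξ (le_of_lt hξ)).1
      have := ((hwC2 i).deriv_regularity_Ioi h).1.hasDerivAt
      rw [hmin.deriv_eq_zero] at this
      exact this.hasDerivWithinAt
  obtain ⟨K, hK, hLip⟩ := exists_abs_sub_le_mul_of_contDiff hf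
  have hle : ∀ y, x ≤ y → w i y ≤ 0 := fun y hy =>
    nonpos_of_deriv_deriv_le_sq_mul (k := √K) (w₁ := deriv (w i)) (w₂ := deriv (deriv (w i)))
      ((hwcont i).mono (Ici_subset_Ici.2 hx))
      (fun z hz => ((hwC2 i).deriv_regularity_Ioi (hx.trans_lt hz)).1.hasDerivAt)
      (fun z hz => ((hwC2 i).deriv_regularity_Ioi (hx.trans_lt hz)).2.hasDerivAt)
      (fun z hz => by
        have hz0 := hx.trans_lt hz
        have h1 := hLip 0 ⟨le_rfl, zero_le_one⟩ (w i z) (hwbd i z hz0.le)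
        rw [hf0, sub_zero, sub_zero, abs_of_nonneg (hwbd i z hz0.le).1] at h1
        have h2 := hwineq i z hz0
        rw [Real.sq_sqrt hK.le]
        linarith [neg_abs_le (f (w i z))])
      hzero.symm hd0 hy
  have : (1 : ℝ) ≤ 0 := le_of_tendsto hwlim ((eventually_ge_atTop x).mono hle)
  linarith

/-- Minimality of the limit profile on a star graph (Theorem 2.2): any
stationary supersolution `w` with values in `[0,1]`, satisfying the
super-Kirchhoff condition at the junction and tending to `1` along edge `i`,
dominates the limit profile `v` of the front-like entire solution. -/
theorem limit_profile_minimal_star (f : ℝ → ℝ) (a : ℝ) (hf : Bistable f a)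
    (c : ℝ) (hc : 0 < c) (φ : ℝ → ℝ) (hφ : TravelingWave f a c φ)
    (N : ℕ) (hN : 2 ≤ N) (ρ : Fin N → ℝ) (hρ : ∀ j, 0 < ρ j) (i : Fin N)
    (u : Fin N → ℝ → ℝ → ℝ) (hu : FrontLike f c φ ρ i u)
    (hmono : ∀ j, ∀ x : ℝ, 0 ≤ x → Monotone fun t => u j t x)
    (v : Fin N → ℝ → ℝ)
    (hv : ∀ j, ∀ x : ℝ, 0 ≤ x → Tendsto (fun t => u j t x) atTop (𝓝 (v j x)))
    (w : Fin N → ℝ → ℝ)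
    (hwcont : ∀ j, ContinuousOn (w j) (Ici 0))
    (hwC2 : ∀ j, ContDiffOn ℝ 2 (w j) (Ioi 0))
    (hwineq : ∀ j, ∀ x : ℝ, 0 < x → deriv (deriv (w j)) x + f (w j x) ≤ 0)
    (hwdiff0 : ∀ j, DifferentiableWithinAt ℝ (w j) (Ici 0) 0)
    (hwbd : ∀ j, ∀ x : ℝ, 0 ≤ x → 0 ≤ w j x ∧ w j x ≤ 1)
    (hwjunc : ∀ j k, w j 0 = w k 0)
    (hwK : (∑ j, ρ j * derivWithin (w j) (Ici 0) 0) ≤ 0)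
    (hwlim : Tendsto (w i) atTop (𝓝 1)) :
    ∀ j, ∀ x : ℝ, 0 ≤ x → v j x ≤ w j x := by
  obtain ⟨hfC, -, -, hf0, -, -, -, -, hf0', -, hf1', -⟩ := hf
  obtain ⟨hφC, -, -, -, hφtop, hφ', -⟩ := hφ
  obtain ⟨hsol, hub, hujunc, huK, hfront⟩ := hu
  obtain ⟨K, hK, hLip⟩ := exists_abs_sub_le_mul_of_contDiff hfC
  obtain ⟨η₀, hη₀, δ₀, hδ₀, hst₀⟩ := exists_sub_le_neg_mul_sub_of_deriv_neg hfC hf0'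
  obtain ⟨η₁, hη₁, δ₁, hδ₁, hst₁⟩ := exists_sub_le_neg_mul_sub_of_deriv_neg hfC hf1'
  obtain ⟨X, hX0, hX⟩ : ∃ X, 0 ≤ X ∧ ∀ x, X ≤ x → 1 - η₁ < w i x := by
    obtain ⟨X, hX⟩ := eventually_atTop.1 (hwlim.eventually_const_lt (u := 1 - η₁) (by linarith))
    exact ⟨max X 0, le_max_right _ _, fun x hx => hX x ((le_max_left _ _).trans hx)⟩
  obtain ⟨m, hm, hmw⟩ : ∃ m > 0, ∀ x ∈ Icc 0 X, m ≤ w i x := by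
    obtain ⟨z, hz, hzmin⟩ := isCompact_Icc.exists_isMinOn (nonempty_Icc.2 hX0)
      ((hwcont i).mono Icc_subset_Ici_self)
    exact ⟨w i z, star_supersolution_pos hfC hf0 hρ hwcont hwC2 hwineq hwdiff0 hwbd hwjunc hwK
      hwlim hz.1, fun x hx => hzmin hx⟩
  have hφanti : StrictAnti φ := strictAnti_of_deriv_neg hφ'
  obtain ⟨Y, hY⟩ := eventually_atTop.1 (hφtop.eventually_lt_const (half_pos hm))
  obtain ⟨T₀, hT₀⟩ := hfront (min (m / 2) η₀) (by positivity)
  set T := min T₀ (-(X + Y) / c) with hT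
  have hearly : ∀ j t x, t ≤ T → 0 < x → w j x < u j t x →
      f (u j t x) - f (w j x) ≤ -min δ₀ δ₁ * (u j t x - w j x) := by
    intro j t x ht hx hlt
    have hT₀' := hT₀ t (ht.trans (min_le_left _ _)) x hx.le
    by_cases hj : j = i
    · subst hj
      by_cases hxX : X ≤ x
      · refine (hst₁ (w j x) (u j t x) (hX x hxX).le hlt.le
          (by linarith [(hub j t x hx.le).2])).trans ?_
        nlinarith [min_le_right δ₀ δ₁]
      · exfalso
        push Not at hxX
        have h1 : t ≤ -(X + Y) / c := ht.trans (min_le_right _ _)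
        rw [le_div_iff₀ hc] at h1
        have h2 := hY (-x - c * t) (by linarith)
        have h3 := (abs_lt.1 (hT₀'.1.trans_le (min_le_left _ _))).2
        linarith [hmw x ⟨hx.le, hxX.le⟩]
    · have h1 := (abs_lt.1 ((hT₀'.2 j hj).trans_le (min_le_right _ _))).2
      refine (hst₀ (w j x) (u j t x) (by linarith [(hwbd j x hx.le).1]) hlt.le
        (by linarith)).trans ?_
      nlinarith [min_le_left δ₀ δ₁]
  have hδ : 0 < min δ₀ δ₁ := lt_min hδ₀ hδ₁
  have hle_T : ∀ j x, 0 ≤ x → u j T x - w j x ≤ 0 := by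
    intro j x hx
    have hbound : ∀ s ≤ T, u j T x - w j x ≤ Real.exp (min δ₀ δ₁ * (s - T)) := by
      intro s hs
      have := star_sub_le_mul_exp hρ hsol hub hujunc huK hwcont hwC2 hwineq hwdiff0
        (fun j x hx => (hwbd j x hx).1) hwjunc hwK (C := -min δ₀ δ₁)
        (M := Real.exp (min δ₀ δ₁ * s)) hs (Real.exp_pos _).le
        (fun j t x _ ht hx hlt => hearly j t x ht hx hlt)
        (fun j x hx => by
          rw [← Real.exp_add, neg_mul, add_neg_cancel, Real.exp_zero]
          linarith [(hub j s x hx).2, (hwbd j x hx).1]) j hx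
      rw [← Real.exp_add] at this
      convert this using 2
      ring
    have hlim : Tendsto (fun s => Real.exp (min δ₀ δ₁ * (s - T))) atBot (𝓝 0) :=
      Real.tendsto_exp_atBot.comp
        ((tendsto_atBot_add_const_right _ (-T) tendsto_id).const_mul_atBot hδ)
    exact ge_of_tendsto hlim ((eventually_le_atBot T).mono hbound)
  intro j x hx
  refine le_of_tendsto (hv j x hx) ((eventually_ge_atTop T).mono fun t ht => ?_)
  have := star_sub_le_mul_exp hρ hsol hub hujunc huK hwcont hwC2 hwineq hwdiff0
    (fun j x hx => (hwbd j x hx).1) hwjunc hwK (C := K) (M := 0) ht le_rfl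
    (fun j t x _ _ hx hlt => by
      have h1 := hLip (w j x) (hwbd j x hx.le) (u j t x)
        ⟨(hub j t x hx.le).1.le, (hub j t x hx.le).2.le⟩
      rw [abs_of_pos (sub_pos.2 hlt)] at h1
      exact (le_abs_self _).trans h1)
    (fun j x hx => by simpa using hle_T j x hx) j hx
  linarith
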